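/- Let M ≥ 2, let 𝒫 be a nonempty ordered set of probability vectors on Fin M, and let D ≥ 0 be real. Define D^(M-1)(𝒫) := sSup {∑_{i=2}^{M} P i | P ∈ 𝒫}. Then there exists a (𝒫,D)-valid mechanism Q with I(P;Q) = 0 for every P ∈ 𝒫 if and only if D ≥ D^(M-1)(𝒫). -/

import Mathlib

open Finset

def IsMech {M : ℕ} (Q : Fin M → Fin M → ℝ) : Prop :=
  (∀ i j, 0 ≤ Q i j) ∧ (∀ i, ∑ j, Q i j = 1)

def IsDP {M : ℕ} (ε : ℝ) (Q : Fin M → Fin M → ℝ) : Prop :=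
  ∀ i₁ i₂ j, Q i₁ j ≤ Real.exp ε * Q i₂ j

def IsProb {M : ℕ} (P : Fin M → ℝ) : Prop :=
  (∀ i, 0 ≤ P i) ∧ ∑ i, P i = 1

def Nonincr {M : ℕ} (P : Fin M → ℝ) : Prop :=
  ∀ i j : Fin M, i ≤ j → P j ≤ P i

noncomputable def epsDP {M : ℕ} (Q : Fin M → Fin M → ℝ) : ℝ :=
  sInf {ε | 0 ≤ ε ∧ IsDP ε Q}

def hamDist {M : ℕ} (P : Fin M → ℝ) (Q : Fin M → Fin M → ℝ) : ℝ :=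
  ∑ i, P i * (1 - Q i i)

def PDValid {M : ℕ} (Ps : Set (Fin M → ℝ)) (D : ℝ) (Q : Fin M → Fin M → ℝ) : Prop :=
  IsMech Q ∧ ∀ P ∈ Ps, hamDist P Q ≤ D

noncomputable def epsStar {M : ℕ} (Ps : Set (Fin M → ℝ)) (D : ℝ) : ℝ :=
  sInf {x | ∃ Q, PDValid Ps D Q ∧ x = epsDP Q}

/-- Mutual information `I(P;Q)` (with the convention `0 * log 0 = 0`, which is automatic
here since any summand with `P i * Q i j = 0` vanishes). -/
noncomputable def MI {M : ℕ} (P : Fin M → ℝ) (Q : Fin M → Fin M → ℝ) : ℝ :=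
  ∑ i, ∑ j, P i * Q i j * Real.log (Q i j / ∑ k, P k * Q k j)

theorem mul_log_div_sub_add_pos {a r : ℝ} (ha : 0 ≤ a) (hr : 0 ≤ r) (h0 : r = 0 → a = 0)
    (hne : a ≠ r) : 0 < a * Real.log (a / r) - a + r := by
  rcases ha.eq_or_lt with rfl | ha
  · simpa using lt_of_le_of_ne hr hne
  · have hr' : 0 < r := lt_of_le_of_ne hr fun h => ha.ne' (h0 h.symm)
    have h1 : r / a ≠ 1 := fun h => hne ((div_eq_one_iff_eq ha.ne').1 h).symm
    have h2 := Real.log_lt_sub_one_of_pos (div_pos hr' ha) h1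
    have h3 : Real.log (a / r) = -Real.log (r / a) := by rw [← Real.log_inv, inv_div]
    have h4 : a * (r / a) = r := by field_simp
    rw [h3]
    nlinarith [mul_lt_mul_of_pos_left h2 ha]

/-- The marginal of the output is a probability vector. -/
theorem sum_output_eq_one {M : ℕ} {P : Fin M → ℝ} {Q : Fin M → Fin M → ℝ}
    (hP : IsProb P) (hQ : IsMech Q) : ∑ j, ∑ k, P k * Q k j = 1 := by
  rw [Finset.sum_comm]
  simp [← Finset.mul_sum, hQ.2, hP.2]

/-- Vanishing mutual information forces each row charged by `P` to be the output marginal. -/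
theorem row_eq_output_of_MI_eq_zero {M : ℕ} {P : Fin M → ℝ} {Q : Fin M → Fin M → ℝ}
    (hP : IsProb P) (hQ : IsMech Q) (h : MI P Q = 0) {i : Fin M} (hi : 0 < P i) (j : Fin M) :
    Q i j = ∑ k, P k * Q k j := by
  set r : Fin M → ℝ := fun j => ∑ k, P k * Q k j with hr
  have hterm : ∀ k j, P k * Q k j ≤ r j := fun k j =>
    Finset.single_le_sum (f := fun k => P k * Q k j)
      (fun k _ => mul_nonneg (hP.1 k) (hQ.1 k j)) (Finset.mem_univ k)
  have hr0 : ∀ j, 0 ≤ r j := fun j =>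
    Finset.sum_nonneg fun k _ => mul_nonneg (hP.1 k) (hQ.1 k j)
  have hpos : ∀ k j, 0 < P k → Q k j ≠ r j →
      0 < P k * (Q k j * Real.log (Q k j / r j) - Q k j + r j) := fun k j hk hne =>
    mul_pos hk <| mul_log_div_sub_add_pos (hQ.1 k j) (hr0 j) (fun h0 => by
      have := hterm k j
      rw [h0] at this
      nlinarith [hQ.1 k j]) hne
  have hnonneg : ∀ k j, 0 ≤ P k * (Q k j * Real.log (Q k j / r j) - Q k j + r j) := by
    intro k j
    rcases (hP.1 k).eq_or_lt with hk | hk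
    · simp [← hk]
    · by_cases hne : Q k j = r j
      · rw [hne]
        by_cases h0 : r j = 0
        · simp [h0]
        · simp [div_self h0]
      · exact (hpos k j hk hne).le
  have hsum : ∑ k, ∑ j, P k * (Q k j * Real.log (Q k j / r j) - Q k j + r j) = 0 := by
    have h1 : ∀ k, ∑ j, P k * (Q k j * Real.log (Q k j / r j) - Q k j + r j)
        = ∑ j, P k * Q k j * Real.log (Q k j / r j) := by
      intro k
      have : ∀ j, P k * (Q k j * Real.log (Q k j / r j) - Q k j + r j)
          = P k * Q k j * Real.log (Q k j / r j) - P k * Q k j + P k * r j := fun j => by ring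
      rw [Finset.sum_congr rfl fun j _ => this j, Finset.sum_add_distrib,
        Finset.sum_sub_distrib, ← Finset.mul_sum univ (Q k), ← Finset.mul_sum univ r, hQ.2, show ∑ j, r j = 1 from sum_output_eq_one hP hQ]
      ring
    rw [Finset.sum_congr rfl fun k _ => h1 k]
    exact h
  by_contra hne
  have hrow := (Finset.sum_eq_zero_iff_of_nonneg
    fun k _ => Finset.sum_nonneg fun j _ => hnonneg k j).1 hsum i (Finset.mem_univ i)
  have hij := (Finset.sum_eq_zero_iff_of_nonneg fun j _ => hnonneg i j).1 hrow j
    (Finset.mem_univ j)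
  exact (hpos i j hi hne).ne' hij

theorem sum_filter_one_le {M : ℕ} (P : Fin (M + 1) → ℝ) (hP : IsProb P) :
    ∑ i ∈ Finset.univ.filter (fun i : Fin (M + 1) => 1 ≤ i.val), P i = 1 - P 0 := by
  have h : Finset.univ.filter (fun i : Fin (M + 1) => 1 ≤ i.val) = Finset.univ.erase 0 := by
    ext i
    simp only [mem_filter, mem_univ, true_and, mem_erase, and_true, ne_eq, Fin.ext_iff,
      Fin.val_zero]
    omega
  rw [h, ← hP.2, ← Finset.add_sum_erase _ _ (Finset.mem_univ (0 : Fin (M + 1)))]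
  ring

theorem one_sub_le_hamDist_of_MI_eq_zero {M : ℕ} {P : Fin (M + 1) → ℝ}
    {Q : Fin (M + 1) → Fin (M + 1) → ℝ} (hP : IsProb P) (hmono : Nonincr P) (hQ : IsMech Q)
    (h : MI P Q = 0) : 1 - P 0 ≤ hamDist P Q := by
  have hle : ∀ i, P i * Q i i ≤ P 0 * ∑ k, P k * Q k i := by
    intro i
    rcases (hP.1 i).eq_or_lt with hi | hi
    · rw [← hi, zero_mul]
      exact mul_nonneg (hP.1 0)
        (Finset.sum_nonneg fun k _ => mul_nonneg (hP.1 k) (hQ.1 k i))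
    · rw [← row_eq_output_of_MI_eq_zero hP hQ h hi i]
      exact mul_le_mul_of_nonneg_right (hmono 0 i (Fin.zero_le i)) (hQ.1 i i)
  have hsum := Finset.sum_le_sum fun i (_ : i ∈ Finset.univ) => hle i
  rw [← Finset.mul_sum, sum_output_eq_one hP hQ] at hsum
  simp only [hamDist, mul_sub, mul_one, Finset.sum_sub_distrib, hP.2]
  linarith

theorem MI_const_eq_zero {M : ℕ} {P : Fin M → ℝ} (hP : IsProb P) (q : Fin M → ℝ) :
    MI P (fun _ => q) = 0 := by
  refine Finset.sum_eq_zero fun i _ => Finset.sum_eq_zero fun j _ => ?_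
  rw [← Finset.sum_mul, hP.2, one_mul]
  by_cases h : q j = 0 <;> simp [h]

theorem stmt14 {M : ℕ} (hM : 2 ≤ M) (Ps : Set (Fin M → ℝ))
    (hne : Ps.Nonempty) (hPs : ∀ P ∈ Ps, IsProb P ∧ Nonincr P)
    (D : ℝ) (hD : 0 ≤ D) :
    (∃ Q : Fin M → Fin M → ℝ, PDValid Ps D Q ∧ ∀ P ∈ Ps, MI P Q = 0) ↔
      sSup {x : ℝ | ∃ P ∈ Ps,
        x = ∑ i ∈ Finset.univ.filter (fun i : Fin M => 1 ≤ i.val), P i} ≤ D := by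
  obtain ⟨N, rfl⟩ : ∃ N, M = N + 1 := ⟨M - 1, by omega⟩
  constructor
  · rintro ⟨Q, ⟨hQ, hdist⟩, hMI⟩
    obtain ⟨P₀, hP₀⟩ := hne
    refine csSup_le ⟨_, P₀, hP₀, rfl⟩ ?_
    rintro x ⟨P, hP, rfl⟩
    rw [sum_filter_one_le P (hPs P hP).1]
    exact (one_sub_le_hamDist_of_MI_eq_zero (hPs P hP).1 (hPs P hP).2 hQ (hMI P hP)).trans
      (hdist P hP)
  · intro h
    refine ⟨fun _ => Pi.single 0 1, ⟨⟨fun i j => ?_, fun i => by simp⟩, fun P hP => ?_⟩,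
      fun P hP => MI_const_eq_zero (hPs P hP).1 _⟩
    · by_cases hj : j = 0 <;> simp [hj]
    · refine le_trans ?_ h
      refine le_trans ?_ (le_csSup ?_ ⟨P, hP, rfl⟩)
      · rw [sum_filter_one_le P (hPs P hP).1]
        simp [hamDist, mul_sub, Finset.sum_sub_distrib, (hPs P hP).1.2, Pi.single_apply]
      · refine ⟨1, ?_⟩
        rintro x ⟨P', hP', rfl⟩
        rw [sum_filter_one_le P' (hPs P' hP').1]
        linarith [(hPs P' hP').1.1 0]
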